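/- Let G and H be finitely generated groups with finite symmetric generating sets and word lengths |·|_G, |·|_H, and suppose there is a measurable embedding of G into H in the integrable sense, i.e. there exist a finite measure space (X,μ) with μ(X) > 0, a measurable measure-preserving action of G on X, and a measurable cocycle α : G × X → H which is an integrable embedding: for every ε > 0 there exist a measurable map φ : X → H, a measurable set X₀ ⊆ X with μ(X₀) > μ(X) − ε, and a constant C > 0 such that the cohomologous cocycle α'(g,x) := φ(g·x)·α(g,x)·φ(x)⁻¹ satisfies ∫_X |α'(g,x)|_H dμ(x) < ∞ for every g ∈ G, and for μ-a.e. x ∈ X₀ and every h ∈ H one has |{g ∈ G : g·x ∈ X₀ and α'(g,x) = h}| ≤ C. Then gr_G ≲ gr_H: there exist constants C₁, C₂ > 0 such that |B_G(n)| ≤ C₁·|B_H(C₂·n)| for all sufficiently large n. -/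

import Mathlib

open MeasureTheory

/-- Word length of `g` with respect to a generating set `S`:
the least `n` such that `g` is a product of `n` elements of `S`. -/
noncomputable def wlen {G : Type*} [Group G] (S : Set G) (g : G) : ℕ :=
  sInf {n : ℕ | ∃ l : List G, (∀ s ∈ l, s ∈ S) ∧ l.length = n ∧ l.prod = g}

theorem wlen_le_of_list {G : Type*} [Group G] {S : Set G} {l : List G} (hl : ∀ s ∈ l, s ∈ S) :
    wlen S l.prod ≤ l.length :=
  Nat.sInf_le ⟨l, hl, rfl, rfl⟩

theorem wlen_one {G : Type*} [Group G] (S : Set G) : wlen S (1 : G) = 0 := by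
  simpa using wlen_le_of_list (S := S) (l := []) (by simp)

/-- Every element of a group generated by a symmetric set has a geodesic word. -/
theorem exists_list_length_eq_wlen {G : Type*} [Group G] {S : Set G}
    (hsymm : ∀ s ∈ S, s⁻¹ ∈ S) (hgen : Subgroup.closure S = ⊤) (g : G) :
    ∃ l : List G, (∀ s ∈ l, s ∈ S) ∧ l.length = wlen S g ∧ l.prod = g := by
  apply Nat.sInf_mem (s := {n : ℕ | ∃ l : List G, (∀ s ∈ l, s ∈ S) ∧ l.length = n ∧ l.prod = g})
  have hg : g ∈ Submonoid.closure (S ∪ S⁻¹) := by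
    rw [← Subgroup.closure_toSubmonoid, hgen]
    exact Subgroup.mem_top g
  obtain ⟨l, hl, hprod⟩ := Submonoid.exists_list_of_mem_closure hg
  refine ⟨l.length, l, fun s hs => ?_, rfl, hprod⟩
  rcases hl s hs with h | h
  · exact h
  · simpa using hsymm _ h

theorem wlen_mul_le {G : Type*} [Group G] {S : Set G}
    (hsymm : ∀ s ∈ S, s⁻¹ ∈ S) (hgen : Subgroup.closure S = ⊤) (g h : G) :
    wlen S (g * h) ≤ wlen S g + wlen S h := by
  obtain ⟨l, hl, hlen, rfl⟩ := exists_list_length_eq_wlen hsymm hgen g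
  obtain ⟨m, hm, hmlen, rfl⟩ := exists_list_length_eq_wlen hsymm hgen h
  rw [← hlen, ← hmlen, ← List.prod_append, ← List.length_append]
  refine wlen_le_of_list fun s hs => ?_
  rcases List.mem_append.1 hs with h | h
  exacts [hl s h, hm s h]

theorem finite_setOf_wlen_le {G : Type*} [Group G] {S : Set G} (hfin : S.Finite)
    (hsymm : ∀ s ∈ S, s⁻¹ ∈ S) (hgen : Subgroup.closure S = ⊤) (r : ℝ) :
    {g : G | (wlen S g : ℝ) ≤ r}.Finite := by
  have := hfin.to_subtype
  refine ((List.finite_length_le S ⌊r⌋₊).image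
    fun l : List S => (l.map Subtype.val).prod).subset fun g hg => ?_
  obtain ⟨l, hl, hlen, rfl⟩ := exists_list_length_eq_wlen hsymm hgen g
  lift l to List S using hl
  refine ⟨l, ?_, rfl⟩
  have : wlen S (l.map Subtype.val).prod ≤ ⌊r⌋₊ := Nat.le_floor hg
  rwa [← hlen, List.length_map] at this

/-- The mean of a family of integrable functions that is subadditive along a measure-preserving
action grows at most linearly in the word length. -/
theorem exists_integral_le_wlen_mul {G X : Type*} [Group G] [MeasurableSpace X] {μ : Measure X}
    {S : Set G} (hfin : S.Finite) (hsymm : ∀ s ∈ S, s⁻¹ ∈ S) (hgen : Subgroup.closure S = ⊤)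
    {T : G → X → X} (hT : ∀ g, MeasurePreserving (T g) μ μ) {f : G → X → ℝ}
    (hf0 : ∀ g x, 0 ≤ f g x) (hfint : ∀ g, Integrable (f g) μ) (hfone : f 1 =ᵐ[μ] 0)
    (hfmul : ∀ g h, ∀ᵐ x ∂μ, f (g * h) x ≤ f g (T h x) + f h x) :
    ∃ K : ℝ, 0 ≤ K ∧ ∀ g, ∫ x, f g x ∂μ ≤ wlen S g * K := by
  have hnonneg : ∀ g, 0 ≤ ∫ x, f g x ∂μ := fun g => integral_nonneg (hf0 g)
  refine ⟨∑ s ∈ hfin.toFinset, ∫ x, f s x ∂μ, Finset.sum_nonneg fun s _ => hnonneg s,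
    fun g => ?_⟩
  obtain ⟨l, hl, hlen, rfl⟩ := exists_list_length_eq_wlen hsymm hgen g
  rw [← hlen]
  clear hlen
  induction l with
  | nil => simp [integral_congr_ae hfone]
  | cons s l ih =>
    have hs : ∫ x, f s x ∂μ ≤ ∑ s ∈ hfin.toFinset, ∫ x, f s x ∂μ :=
      Finset.single_le_sum (f := fun s => ∫ x, f s x ∂μ) (fun s _ => hnonneg s)
        (hfin.mem_toFinset.2 (hl s (by simp)))
    have hl' := ih fun t ht => hl t (by simp [ht])
    have hcomp : Integrable (fun x => f s (T l.prod x)) μ :=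
      (hT l.prod).integrable_comp_of_integrable (hfint s)
    have heq : ∫ x, f s (T l.prod x) ∂μ = ∫ x, f s x ∂μ := by
      have := integral_map (μ := μ) (hT l.prod).aemeasurable (f := f s)
        (by rw [(hT l.prod).map_eq]; exact (hfint s).aestronglyMeasurable)
      rw [(hT l.prod).map_eq] at this
      exact this.symm
    have hle := integral_mono_ae (hfint (s * l.prod)) (hcomp.add (hfint l.prod))
      (hfmul s l.prod)
    simp only [Pi.add_apply] at hle
    rw [integral_add hcomp (hfint l.prod), heq] at hle
    simp only [List.prod_cons, List.length_cons, Nat.cast_add, Nat.cast_one]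
    linarith

/-- Double counting: if every set of a finite family has measure at least `a` and almost every
point lies in at most `c` of them, then the family has at most `c * μ univ / a` members. -/
theorem card_mul_le_of_ae_card_filter_le {ι X : Type*} [MeasurableSpace X] {μ : Measure X}
    [IsFiniteMeasure μ] (s : Finset ι) {E : ι → Set X} (hE : ∀ i, NullMeasurableSet (E i) μ)
    {a c : ℝ} (ha : ∀ i ∈ s, a ≤ μ.real (E i))
    (hc : ∀ᵐ x ∂μ, (({i ∈ (s : Set ι) | x ∈ E i}).ncard : ℝ) ≤ c) :
    s.card * a ≤ c * μ.real Set.univ := by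
  classical
  have hint : ∀ i, Integrable ((E i).indicator fun _ => (1 : ℝ)) μ := fun i =>
    (integrable_const (1 : ℝ)).indicator₀ (hE i)
  have hval : ∀ i, ∫ x, (E i).indicator (fun _ => (1 : ℝ)) x ∂μ = μ.real (E i) := fun i => by
    rw [integral_indicator₀ (hE i)]
    simp
  calc s.card * a = ∑ _i ∈ s, a := by simp
    _ ≤ ∑ i ∈ s, μ.real (E i) := Finset.sum_le_sum ha
    _ = ∫ x, ∑ i ∈ s, (E i).indicator (fun _ => (1 : ℝ)) x ∂μ := by
      rw [integral_finsetSum s fun i _ => hint i]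
      simp only [hval]
    _ ≤ ∫ _x, c ∂μ := by
      refine integral_mono_ae (integrable_finsetSum s fun i _ => hint i) (integrable_const c) ?_
      filter_upwards [hc] with x hx
      have hset : {i ∈ (s : Set ι) | x ∈ E i} = ((s.filter fun i => x ∈ E i : Finset ι) : Set ι) := by
        ext i
        simp
      rw [hset, Set.ncard_coe_finset] at hx
      simpa [Set.indicator_apply, Finset.sum_boole] using hx
    _ = c * μ.real Set.univ := by simp [mul_comm]

theorem stmt13 {G H : Type*} [Group G] [Group H]
    (SG : Set G) (hSGfin : SG.Finite) (hSGsymm : ∀ s ∈ SG, s⁻¹ ∈ SG)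
    (hSGgen : Subgroup.closure SG = ⊤)
    (SH : Set H) (hSHfin : SH.Finite) (hSHsymm : ∀ s ∈ SH, s⁻¹ ∈ SH)
    (hSHgen : Subgroup.closure SH = ⊤)
    {X : Type*} [MeasurableSpace X] (μ : Measure X) [IsFiniteMeasure μ] (hμ : μ ≠ 0)
    (T : G → X → X) (hTmeas : ∀ g, Measurable (T g))
    (hT1 : ∀ x, T 1 x = x) (hTmul : ∀ g h x, T (g * h) x = T g (T h x))
    (hTpres : ∀ g, MeasurePreserving (T g) μ μ)
    (α : G → X → H) (hαmeas : ∀ (g : G) (h : H), MeasurableSet {x | α g x = h})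
    (hαcoc : ∀ g₁ g₂ : G, ∀ᵐ x ∂μ, α (g₂ * g₁) x = α g₂ (T g₁ x) * α g₁ x)
    -- `α` is an integrable embedding:
    (hemb : ∀ ε : ℝ, 0 < ε → ∃ φ : X → H,
      (∀ h : H, MeasurableSet {x | φ x = h}) ∧
      ∃ X₀ : Set X, MeasurableSet X₀ ∧ (μ Set.univ).toReal - ε < (μ X₀).toReal ∧
      ∃ C : ℕ, 0 < C ∧
        (∀ g : G,
          Integrable (fun x => (wlen SH (φ (T g x) * α g x * (φ x)⁻¹) : ℝ)) μ) ∧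
        (∀ᵐ x ∂μ, x ∈ X₀ → ∀ h : H,
          {g : G | T g x ∈ X₀ ∧ φ (T g x) * α g x * (φ x)⁻¹ = h}.Finite ∧
          ({g : G | T g x ∈ X₀ ∧ φ (T g x) * α g x * (φ x)⁻¹ = h}).ncard ≤ C)) :
    ∃ C₁ C₂ : ℝ, 0 < C₁ ∧ 0 < C₂ ∧ ∃ N : ℕ, ∀ n : ℕ, N ≤ n →
      (({g : G | wlen SG g ≤ n}).ncard : ℝ) ≤
        C₁ * (({h : H | (wlen SH h : ℝ) ≤ C₂ * n}).ncard : ℝ) := by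
  set M : ℝ := μ.real Set.univ with hM
  have hMpos : 0 < M := by
    have : NeZero μ := ⟨hμ⟩
    exact measureReal_univ_pos
  obtain ⟨φ, -, X₀, hX₀, hX₀μ, C, hC, hint, hmult⟩ := hemb (M / 4) (by positivity)
  change M - M / 4 < μ.real X₀ at hX₀μ
  have hone : ∀ᵐ x ∂μ, α 1 x = 1 := by
    filter_upwards [hαcoc 1 1] with x hx
    rw [hT1, mul_one] at hx
    exact left_eq_mul.1 hx
  obtain ⟨K, hK0, hK⟩ := exists_integral_le_wlen_mul hSGfin hSGsymm hSGgen hTpres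
    (f := fun g x => (wlen SH (φ (T g x) * α g x * (φ x)⁻¹) : ℝ))
    (fun g x => Nat.cast_nonneg _) hint
    (by filter_upwards [hone] with x hx; simp [hx, hT1, wlen_one])
    (fun g h => by
      filter_upwards [hαcoc h g] with x hx
      have := wlen_mul_le hSHsymm hSHgen (φ (T g (T h x)) * α g (T h x) * (φ (T h x))⁻¹)
        (φ (T h x) * α h x * (φ x)⁻¹)
      rw [hx, hTmul]
      have heq : φ (T g (T h x)) * α g (T h x) * (φ (T h x))⁻¹ * (φ (T h x) * α h x * (φ x)⁻¹)
          = φ (T g (T h x)) * (α g (T h x) * α h x) * (φ x)⁻¹ := by group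
      rw [heq] at this
      exact_mod_cast this)
  set R : ℝ := 4 * (K + 1) / M with hR
  have hRpos : 0 < R := by positivity
  refine ⟨4 * C, R, by positivity, hRpos, 1, fun n hn => ?_⟩
  have hn' : (0 : ℝ) < n := by exact_mod_cast hn
  have hGfin : {g : G | wlen SG g ≤ n}.Finite := by
    simpa using finite_setOf_wlen_le hSGfin hSGsymm hSGgen (n : ℝ)
  have hHfin := finite_setOf_wlen_le hSHfin hSHsymm hSHgen (R * n)
  set L : G → X → ℝ := fun g x => (wlen SH (φ (T g x) * α g x * (φ x)⁻¹) : ℝ) with hL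
  have hLmeas : ∀ g, NullMeasurableSet {x | R * n ≤ L g x} μ := fun g =>
    nullMeasurableSet_le aemeasurable_const (hint g).aemeasurable
  have hpre : ∀ g, MeasurableSet (T g ⁻¹' X₀) := fun g => hTmeas g hX₀
  have hbound : ∀ g ∈ hGfin.toFinset,
      M / 4 ≤ μ.real (X₀ ∩ T g ⁻¹' X₀ ∩ {x | R * n ≤ L g x}ᶜ) := by
    intro g hg
    have hgn : (wlen SG g : ℝ) ≤ n := by exact_mod_cast hGfin.mem_toFinset.1 hg
    have hmarkov : R * n * μ.real {x | R * n ≤ L g x} ≤ n * K :=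
      (mul_meas_ge_le_integral_of_nonneg (Filter.Eventually.of_forall fun x => Nat.cast_nonneg _)
        (hint g) (R * n)).trans ((hK g).trans (by gcongr))
    have hbad : μ.real {x | R * n ≤ L g x} ≤ M / 4 := by
      have hRM : R * (M / 4) = K + 1 := by
        rw [hR]
        field_simp
      by_contra! hlt
      have : R * n * (M / 4) < R * n * μ.real {x | R * n ≤ L g x} := by gcongr
      nlinarith
    have hpreμ : μ.real (T g ⁻¹' X₀) = μ.real X₀ :=
      (hTpres g).measureReal_preimage hX₀.nullMeasurableSet
    have hcompl : μ.real X₀ᶜ = M - μ.real X₀ := measureReal_compl hX₀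
    have hprecompl : μ.real (T g ⁻¹' X₀)ᶜ = M - μ.real X₀ := by
      rw [measureReal_compl (hpre g), hpreμ]
    have hcover : M ≤ μ.real (X₀ ∩ T g ⁻¹' X₀ ∩ {x | R * n ≤ L g x}ᶜ)
        + (μ.real X₀ᶜ + μ.real (T g ⁻¹' X₀)ᶜ + μ.real {x | R * n ≤ L g x}) := by
      have hsub : (Set.univ : Set X) ⊆ (X₀ ∩ T g ⁻¹' X₀ ∩ {x | R * n ≤ L g x}ᶜ) ∪
          (X₀ᶜ ∪ (T g ⁻¹' X₀)ᶜ ∪ {x | R * n ≤ L g x}) := fun x _ => by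
        simp only [Set.mem_union, Set.mem_inter_iff, Set.mem_compl_iff]
        tauto
      refine (measureReal_mono hsub).trans ((measureReal_union_le _ _).trans ?_)
      gcongr
      refine (measureReal_union_le _ _).trans ?_
      gcongr
      exact measureReal_union_le _ _
    linarith
  have hcount := card_mul_le_of_ae_card_filter_le (μ := μ) hGfin.toFinset
    (E := fun g => X₀ ∩ T g ⁻¹' X₀ ∩ {x | R * n ≤ L g x}ᶜ)
    (fun g => (hX₀.inter (hpre g)).nullMeasurableSet.inter (hLmeas g).compl) hbound
    (c := C * ({h : H | (wlen SH h : ℝ) ≤ R * n}).ncard)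
    (by
      classical
      filter_upwards [hmult] with x hx
      by_cases hxX : x ∈ X₀
      swap
      · simp only [Set.mem_inter_iff, hxX, false_and, and_false, Set.ofPred_false, Set.ncard_empty,
          Nat.cast_zero]
        positivity
      set F := hGfin.toFinset.filter fun g => x ∈ X₀ ∩ T g ⁻¹' X₀ ∩ {x | R * n ≤ L g x}ᶜ with hF
      have hset : {g ∈ (hGfin.toFinset : Set G) | x ∈ X₀ ∩ T g ⁻¹' X₀ ∩ {x | R * n ≤ L g x}ᶜ}
          = (F : Set G) := by
        rw [hF, Finset.coe_filter]
        rfl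
      have hmem : ∀ g ∈ F, T g x ∈ X₀ ∧ L g x < R * n := fun g hg => by
        have := (Finset.mem_filter.1 hg).2
        exact ⟨this.1.2, not_le.1 this.2⟩
      rw [hset, Set.ncard_coe_finset, Set.ncard_eq_toFinset_card _ hHfin]
      exact_mod_cast Finset.card_le_mul_card_image_of_maps_to
        (f := fun g => φ (T g x) * α g x * (φ x)⁻¹)
        (fun g hg => hHfin.mem_toFinset.2 (hmem g hg).2.le) C fun h _ => by
          rw [← Set.ncard_coe_finset]
          refine (Set.ncard_le_ncard (fun g hg => ?_) (hx hxX h).1).trans (hx hxX h).2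
          obtain ⟨hgF, hgh⟩ := Finset.mem_filter.1 hg
          exact ⟨(hmem g hgF).1, hgh⟩)
  rw [Set.ncard_eq_toFinset_card _ hGfin]
  rw [← hM] at hcount
  refine le_of_mul_le_mul_right ?_ hMpos
  linarith
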